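/- For real numbers a, b with 0 < b < a, the improper integral ∫₀^∞ J₀(a x) sin(b x) dx converges and equals 0. -/

import Mathlib

noncomputable def besselJ0 (z : ℝ) : ℝ :=
  ∑' m : ℕ, (-1) ^ m * (z / 2) ^ (2 * m) / ((m.factorial : ℝ)) ^ 2

open Filter Topology Set MeasureTheory

/-- The entire functions `∑ (-t)^m / (m! (m+k)!)`. -/
noncomputable def bg (k : ℕ) (t : ℝ) : ℝ :=
  ∑' m : ℕ, (-t) ^ m / ((m.factorial : ℝ) * ((m + k).factorial : ℝ))

lemma bg_term_bound (k m : ℕ) (t r : ℝ) (h : |t| ≤ r) :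
    ‖(-t) ^ m / ((m.factorial : ℝ) * ((m + k).factorial : ℝ))‖ ≤ r ^ m / (m.factorial : ℝ) := by
  have h1 : (1 : ℝ) ≤ ((m + k).factorial : ℝ) := by exact_mod_cast Nat.factorial_pos (m + k)
  have h2 : (0 : ℝ) < (m.factorial : ℝ) := by exact_mod_cast Nat.factorial_pos m
  have hr : 0 ≤ r := (abs_nonneg t).trans h
  rw [norm_div, norm_pow, norm_neg, Real.norm_eq_abs, Real.norm_eq_abs,
    abs_of_pos (by positivity : (0 : ℝ) < (m.factorial : ℝ) * ((m + k).factorial : ℝ))]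
  gcongr
  nlinarith

lemma bg_summable (k : ℕ) (t : ℝ) :
    Summable fun m : ℕ => (-t) ^ m / ((m.factorial : ℝ) * ((m + k).factorial : ℝ)) :=
  Summable.of_norm_bounded (Real.summable_pow_div_factorial |t|)
    fun m => bg_term_bound k m t |t| le_rfl

lemma bg_hasDerivAt (k : ℕ) (t : ℝ) : HasDerivAt (bg k) (-bg (k + 1) t) t := by
  set r := |t| + 1 with hr
  have hder : ∀ (n : ℕ) (y : ℝ), HasDerivAt
      (fun y : ℝ => (-y) ^ n / ((n.factorial : ℝ) * ((n + k).factorial : ℝ)))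
      ((n : ℝ) * (-y) ^ (n - 1) * (-1) / ((n.factorial : ℝ) * ((n + k).factorial : ℝ))) y := by
    intro n y
    exact ((hasDerivAt_neg y).pow n).div_const _
  have hshift : ∀ (n : ℕ) (y : ℝ),
      (((n + 1 : ℕ) : ℝ) * (-y) ^ (n + 1 - 1) * (-1) /
        (((n + 1).factorial : ℝ) * ((n + 1 + k).factorial : ℝ))) =
      -((-y) ^ n / ((n.factorial : ℝ) * ((n + (k + 1)).factorial : ℝ))) := by
    intro n y
    have e : n + 1 + k = n + (k + 1) := by ring
    rw [e, Nat.factorial_succ n]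
    have h1 : ((n + (k + 1)).factorial : ℝ) ≠ 0 := by exact_mod_cast Nat.factorial_ne_zero _
    have h2 : (n.factorial : ℝ) ≠ 0 := by exact_mod_cast Nat.factorial_ne_zero _
    have h3 : (n : ℝ) + 1 ≠ 0 := by positivity
    push_cast
    field_simp
  let u : ℕ → ℝ := fun n => match n with
    | 0 => 0
    | n + 1 => r ^ n / (n.factorial : ℝ)
  have hu : Summable u := (summable_nat_add_iff 1).1 (Real.summable_pow_div_factorial r)
  have key := hasDerivAt_tsum_of_isPreconnected (y₀ := t) (y := t) (t := Metric.ball (0 : ℝ) r) hu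
    Metric.isOpen_ball (convex_ball (0 : ℝ) r).isPreconnected (fun n y _ => hder n y) ?_ ?_
    (bg_summable k t) ?_
  · have hs : (∑' n : ℕ, ((n : ℝ) * (-t) ^ (n - 1) * (-1) /
        ((n.factorial : ℝ) * ((n + k).factorial : ℝ)))) = -bg (k + 1) t := by
      rw [tsum_eq_zero_add']
      · simp only [hshift, tsum_neg]
        simp [bg]
      · simp only [hshift]
        exact (bg_summable (k + 1) t).neg
    rw [hs] at key
    exact key
  · intro n y hy
    cases n with
    | zero => simp [u]
    | succ n =>
      rw [hshift, norm_neg]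
      refine bg_term_bound (k + 1) n y r ?_
      rw [Metric.mem_ball, dist_zero_right] at hy
      exact hy.le
  · simp [hr]
  · simp [hr]

lemma bg_rec (t : ℝ) : t * bg 2 t - bg 1 t + bg 0 t = 0 := by
  have h0 := bg_summable 0 t
  have h1 := bg_summable 1 t
  have h2 := bg_summable 2 t
  have e : bg 1 t - bg 0 t = t * bg 2 t := by
    unfold bg
    rw [← h1.tsum_sub h0, (h1.sub h0).tsum_eq_zero_add, ← tsum_mul_left]
    have hz : (-t) ^ 0 / (((0 : ℕ).factorial : ℝ) * ((0 + 1 : ℕ).factorial : ℝ))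
        - (-t) ^ 0 / (((0 : ℕ).factorial : ℝ) * ((0 + 0 : ℕ).factorial : ℝ)) = 0 := by
      simp
    rw [hz, zero_add]
    refine tsum_congr fun n => ?_
    have a2 : (n.factorial : ℝ) ≠ 0 := by exact_mod_cast Nat.factorial_ne_zero _
    have a3 : (n : ℝ) + 1 ≠ 0 := by positivity
    have a4 : (n : ℝ) + 1 + 1 ≠ 0 := by positivity
    have e1 : ((n + 1).factorial : ℝ) = (n + 1) * n.factorial := by
      rw [Nat.factorial_succ]; push_cast; ring
    have e2 : ((n + 2).factorial : ℝ) = (n + 1 + 1) * ((n + 1) * n.factorial) := by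
      rw [Nat.factorial_succ, Nat.factorial_succ]; push_cast; ring
    rw [add_zero, show n + 1 + 1 = n + 2 from rfl, e1, e2]
    field_simp
    ring
  linarith

lemma besselJ0_eq (x : ℝ) : besselJ0 x = bg 0 (x ^ 2 / 4) := by
  unfold besselJ0 bg
  refine tsum_congr fun m => ?_
  rw [pow_mul, ← mul_pow, add_zero, ← sq]
  congr 2
  ring

/-- The derivative of `J₀`. -/
noncomputable def bp (x : ℝ) : ℝ := -(x / 2) * bg 1 (x ^ 2 / 4)

lemma besselJ0_hasDerivAt (x : ℝ) : HasDerivAt besselJ0 (bp x) x := by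
  have e : besselJ0 = fun x => bg 0 (x ^ 2 / 4) := funext besselJ0_eq
  rw [e]
  have h1 : HasDerivAt (fun x : ℝ => x ^ 2 / 4) (x / 2) x := by
    refine ((hasDerivAt_pow 2 x).div_const 4).congr_deriv ?_
    norm_num
    ring
  have := (bg_hasDerivAt 0 (x ^ 2 / 4)).comp x h1
  refine this.congr_deriv ?_
  unfold bp
  ring

lemma bp_hasDerivAt (x : ℝ) :
    ∃ q, HasDerivAt bp q x ∧ x * q = -bp x - x * besselJ0 x := by
  have h1 : HasDerivAt (fun x : ℝ => x ^ 2 / 4) (x / 2) x := by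
    refine ((hasDerivAt_pow 2 x).div_const 4).congr_deriv ?_
    norm_num
    ring
  have h2 : HasDerivAt (fun x : ℝ => -(x / 2)) (-(1 / 2)) x := ((hasDerivAt_id x).div_const 2).neg
  have h3 := (bg_hasDerivAt 1 (x ^ 2 / 4)).comp x h1
  refine ⟨_, h2.mul h3, ?_⟩
  have := bg_rec (x ^ 2 / 4)
  rw [besselJ0_eq]
  unfold bp
  linear_combination x * this

lemma xbp_hasDerivAt (x : ℝ) : HasDerivAt (fun x => x * bp x) (-(x * besselJ0 x)) x := by
  obtain ⟨q, hq, h⟩ := bp_hasDerivAt x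
  refine ((hasDerivAt_id' x).mul hq).congr_deriv ?_
  linarith

lemma besselJ0_cont : Continuous besselJ0 :=
  continuous_iff_continuousAt.2 fun x => (besselJ0_hasDerivAt x).continuousAt

/-- Energy bound. -/
lemma energy : ∃ C : ℝ, ∀ x, 1 ≤ x → x * besselJ0 x ^ 2 ≤ C ∧ x * bp x ^ 2 ≤ C := by
  let V : ℝ → ℝ := fun x => x * bp x * bp x + x * besselJ0 x * besselJ0 x + besselJ0 x * bp x
    + besselJ0 x * besselJ0 x / (2 * x)
  have hV : ∀ x, 1 ≤ x → HasDerivAt V (-(besselJ0 x ^ 2 / (2 * x ^ 2))) x := by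
    intro x hx
    have hx0 : x ≠ 0 := by positivity
    obtain ⟨q, hq, h⟩ := bp_hasDerivAt x
    have hy := besselJ0_hasDerivAt x
    have hid := hasDerivAt_id' x
    have h1 := ((((hid.mul hq).mul hq).add ((hid.mul hy).mul hy)).add (hy.mul hq)).add
      ((hy.mul hy).div (hid.const_mul 2) (by positivity))
    refine h1.congr_deriv ?_
    have hq' : q = (-bp x - x * besselJ0 x) / x := by field_simp; linarith
    rw [hq']
    simp only [Pi.mul_apply]
    field_simp
    ring
  have hanti : AntitoneOn V (Ici 1) := by
    refine antitoneOn_of_deriv_nonpos (convex_Ici 1)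
      (fun x hx => (hV x hx).continuousAt.continuousWithinAt)
      (fun x hx => ?_) (fun x hx => ?_)
    · rw [interior_Ici] at hx
      exact (hV x (le_of_lt hx)).differentiableAt.differentiableWithinAt
    · rw [interior_Ici] at hx
      rw [(hV x (le_of_lt hx)).deriv, neg_nonpos]
      positivity
  refine ⟨2 * V 1, fun x hx => ?_⟩
  have hle : V x ≤ V 1 := hanti (mem_Ici.2 le_rfl) (mem_Ici.2 hx) hx
  have hx0 : 0 < x := by linarith
  have e : V x = x * besselJ0 x ^ 2 + x * bp x ^ 2 / 2 + x * (bp x + besselJ0 x / x) ^ 2 / 2 := by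
    simp only [V]
    field_simp
    ring
  have p1 : 0 ≤ x * besselJ0 x ^ 2 := by positivity
  have p2 : 0 ≤ x * bp x ^ 2 / 2 := by positivity
  have p3 : 0 ≤ x * (bp x + besselJ0 x / x) ^ 2 / 2 := by positivity
  constructor <;> linarith

lemma tendsto_zero_of_energy (f : ℝ → ℝ) (C : ℝ) (h : ∀ x, 1 ≤ x → x * f x ^ 2 ≤ C) :
    Tendsto f atTop (𝓝 0) := by
  have h2 : Tendsto (fun x => f x ^ 2) atTop (𝓝 0) := by
    refine squeeze_zero' (Eventually.of_forall fun x => sq_nonneg _) ?_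
      (tendsto_const_nhds.div_atTop tendsto_id : Tendsto (fun x : ℝ => C / x) atTop (𝓝 0))
    filter_upwards [eventually_ge_atTop 1] with x hx
    rw [le_div_iff₀ (by linarith)]
    linarith [h x hx]
  have h3 := h2.sqrt
  simp only [Real.sqrt_sq_eq_abs, Real.sqrt_zero] at h3
  exact (tendsto_zero_iff_abs_tendsto_zero f).2 h3

lemma K_hasDerivAt (R t : ℝ) :
    HasDerivAt (fun t => ∫ x in (0 : ℝ)..R, besselJ0 x * Real.sin (t * x))
      (∫ x in (0 : ℝ)..R, besselJ0 x * (x * Real.cos (t * x))) t := by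
  have hc := besselJ0_cont
  refine (intervalIntegral.hasDerivAt_integral_of_dominated_loc_of_deriv_le
    (F := fun t x => besselJ0 x * Real.sin (t * x))
    (F' := fun t x => besselJ0 x * (x * Real.cos (t * x)))
    (bound := fun x => |besselJ0 x| * |x|) univ_mem ?_ ?_ ?_ ?_ ?_ ?_).2
  · exact Eventually.of_forall fun s => Continuous.aestronglyMeasurable (by fun_prop)
  · exact Continuous.intervalIntegrable (by fun_prop) _ _
  · exact Continuous.aestronglyMeasurable (by fun_prop)
  · refine Eventually.of_forall fun x _ s _ => ?_
    simp only [norm_mul, Real.norm_eq_abs]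
    have := Real.abs_cos_le_one (s * x)
    gcongr
    exact mul_le_of_le_one_right (abs_nonneg _) this
  · exact Continuous.intervalIntegrable (by fun_prop) _ _
  · refine Eventually.of_forall fun x _ s _ => ?_
    have h := ((hasDerivAt_id' s).mul_const x).sin.const_mul (besselJ0 x)
    refine h.congr_deriv ?_
    ring

lemma K_ode (R t : ℝ) :
    (1 - t ^ 2) * (∫ x in (0 : ℝ)..R, besselJ0 x * (x * Real.cos (t * x)))
      - t * (∫ x in (0 : ℝ)..R, besselJ0 x * Real.sin (t * x))
      = -(R * bp R * Real.cos (t * R)) - t * (R * besselJ0 R * Real.sin (t * R)) := by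
  have hc := besselJ0_cont
  have h := intervalIntegral.integral_eq_sub_of_hasDerivAt (a := 0) (b := R)
    (f := fun x => -(x * bp x * Real.cos (t * x)) - t * (x * besselJ0 x * Real.sin (t * x)))
    (f' := fun x => (1 - t ^ 2) * (besselJ0 x * (x * Real.cos (t * x)))
      - t * (besselJ0 x * Real.sin (t * x))) ?_ ?_
  · rw [intervalIntegral.integral_sub, intervalIntegral.integral_const_mul,
      intervalIntegral.integral_const_mul] at h
    · rw [h]; simp
    · exact Continuous.intervalIntegrable (by fun_prop) _ _
    · exact Continuous.intervalIntegrable (by fun_prop) _ _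
  · intro x _
    have hid := (hasDerivAt_id' x).const_mul t
    have h1 := ((xbp_hasDerivAt x).mul hid.cos).neg.sub
      ((((hasDerivAt_id' x).mul (besselJ0_hasDerivAt x)).mul hid.sin).const_mul t)
    refine h1.congr_deriv ?_
    simp only [Pi.mul_apply]
    ring
  · exact Continuous.intervalIntegrable (by fun_prop) _ _

lemma K_bound (b : ℝ) (hb : 0 < b) (hb1 : b < 1) (R : ℝ) :
    |√(1 - b ^ 2) * (∫ x in (0 : ℝ)..R, besselJ0 x * Real.sin (b * x))
      + bp R * Real.sin (b * R) / √(1 - b ^ 2)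
      - b * besselJ0 R * Real.cos (b * R) / √(1 - b ^ 2)|
      ≤ (|bp R| + |besselJ0 R|) / √(1 - b ^ 2) ^ 3 * b := by
  let Φ : ℝ → ℝ := fun t => √(1 - t ^ 2) * (∫ x in (0 : ℝ)..R, besselJ0 x * Real.sin (t * x))
      + bp R * Real.sin (t * R) / √(1 - t ^ 2)
      - t * besselJ0 R * Real.cos (t * R) / √(1 - t ^ 2)
  have hpos : ∀ t ∈ Icc 0 b, 0 < 1 - t ^ 2 := by
    intro t ht
    nlinarith [ht.1, ht.2]
  have hd : ∀ t ∈ Icc 0 b, HasDerivAt Φ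
      ((t * bp R * Real.sin (t * R) - besselJ0 R * Real.cos (t * R)) / √(1 - t ^ 2) ^ 3) t := by
    intro t ht
    have hp := hpos t ht
    have hw : 0 < √(1 - t ^ 2) := Real.sqrt_pos.2 hp
    have hw2 : √(1 - t ^ 2) ^ 2 = 1 - t ^ 2 := Real.sq_sqrt hp.le
    have hwd : HasDerivAt (fun t : ℝ => √(1 - t ^ 2)) (-t / √(1 - t ^ 2)) t := by
      have := ((hasDerivAt_pow 2 t).const_sub 1).sqrt hp.ne'
      refine this.congr_deriv ?_
      field_simp
      norm_num
    have hid := (hasDerivAt_id' t).mul_const R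
    have h1 := ((hwd.mul (K_hasDerivAt R t)).add
      ((hid.sin.const_mul (bp R)).div hwd hw.ne')).sub
      ((((hasDerivAt_id' t).mul_const (besselJ0 R)).mul hid.cos).div hwd hw.ne')
    refine h1.congr_deriv ?_
    have ode := K_ode R t
    simp only [Pi.mul_apply]
    generalize (∫ x in (0 : ℝ)..R, besselJ0 x * (x * Real.cos (t * x))) = M at ode ⊢
    generalize (∫ x in (0 : ℝ)..R, besselJ0 x * Real.sin (t * x)) = K at ode ⊢
    generalize √(1 - t ^ 2) = w at hw hw2 ⊢
    have ht2 : t ^ 2 = 1 - w ^ 2 := by linarith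
    rw [← hw2] at ode
    field_simp
    linear_combination w ^ 2 * ode - besselJ0 R * Real.cos (t * R) * hw2
  have hb2 := hpos b ⟨hb.le, le_rfl⟩
  have := norm_image_sub_le_of_norm_deriv_le_segment' (C := (|bp R| + |besselJ0 R|) / √(1 - b ^ 2) ^ 3)
    (fun t ht => (hd t ht).hasDerivWithinAt) ?_ b ⟨hb.le, le_rfl⟩
  · simpa [Φ] using this
  · intro t ht
    have hwb : 0 < √(1 - b ^ 2) := Real.sqrt_pos.2 hb2
    have hle : √(1 - b ^ 2) ≤ √(1 - t ^ 2) := by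
      apply Real.sqrt_le_sqrt
      nlinarith [ht.1, ht.2]
    rw [norm_div, norm_pow, Real.norm_eq_abs, Real.norm_eq_abs, abs_of_nonneg (Real.sqrt_nonneg _)]
    gcongr
    refine (abs_sub _ _).trans ?_
    simp only [abs_mul]
    have s1 := Real.abs_sin_le_one (t * R)
    have c1 := Real.abs_cos_le_one (t * R)
    have t1 : |t| ≤ 1 := by rw [abs_of_nonneg ht.1]; linarith [ht.2]
    have : |t| * |bp R| ≤ |bp R| := mul_le_of_le_one_left (abs_nonneg _) t1
    have : |t| * |bp R| * |Real.sin (t * R)| ≤ |t| * |bp R| :=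
      mul_le_of_le_one_right (by positivity) s1
    have : |besselJ0 R| * |Real.cos (t * R)| ≤ |besselJ0 R| :=
      mul_le_of_le_one_right (by positivity) c1
    linarith

lemma K_tendsto (b : ℝ) (hb : 0 < b) (hb1 : b < 1) :
    Tendsto (fun R : ℝ => ∫ x in (0 : ℝ)..R, besselJ0 x * Real.sin (b * x)) atTop (𝓝 0) := by
  obtain ⟨C, hC⟩ := energy
  have hy := tendsto_zero_of_energy besselJ0 C fun x hx => (hC x hx).1
  have hp := tendsto_zero_of_energy bp C fun x hx => (hC x hx).2
  have hw : 0 < √(1 - b ^ 2) := Real.sqrt_pos.2 (by nlinarith)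
  have hbd : Tendsto (fun R => (|bp R| + |besselJ0 R|) / √(1 - b ^ 2) ^ 3 * b) atTop (𝓝 0) := by
    have := ((hp.abs.add hy.abs).div_const (√(1 - b ^ 2) ^ 3)).mul_const b
    simpa using this
  have h1 : Tendsto (fun R => √(1 - b ^ 2) * (∫ x in (0 : ℝ)..R, besselJ0 x * Real.sin (b * x))
      + bp R * Real.sin (b * R) / √(1 - b ^ 2)
      - b * besselJ0 R * Real.cos (b * R) / √(1 - b ^ 2)) atTop (𝓝 0) :=
    squeeze_zero_norm (fun R => K_bound b hb hb1 R) hbd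
  have hs : Tendsto (fun R => bp R * Real.sin (b * R)) atTop (𝓝 0) := by
    refine squeeze_zero_norm (fun R => ?_) (by simpa using hp.abs)
    rw [norm_mul]
    exact mul_le_of_le_one_right (abs_nonneg _) (Real.abs_sin_le_one _)
  have hcs : Tendsto (fun R => besselJ0 R * Real.cos (b * R)) atTop (𝓝 0) := by
    refine squeeze_zero_norm (fun R => ?_) (by simpa using hy.abs)
    rw [norm_mul]
    exact mul_le_of_le_one_right (abs_nonneg _) (Real.abs_cos_le_one _)
  have h2 := ((h1.sub (hs.div_const √(1 - b ^ 2))).add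
    ((hcs.const_mul b).div_const √(1 - b ^ 2))).div_const √(1 - b ^ 2)
  simp only [mul_zero, zero_div, sub_zero, add_zero] at h2
  refine h2.congr fun R => ?_
  field_simp
  ring

theorem bessel_sin_integral_zero (a b : ℝ) (hb : 0 < b) (hab : b < a) :
    Filter.Tendsto (fun R : ℝ => ∫ x in (0 : ℝ)..R, besselJ0 (a * x) * Real.sin (b * x))
      Filter.atTop (nhds 0) := by
  have ha : 0 < a := hb.trans hab
  have h := K_tendsto (b / a) (by positivity) ((div_lt_one ha).2 hab)
  have h2 := (h.comp (tendsto_id.const_mul_atTop ha)).const_mul a⁻¹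
  rw [mul_zero] at h2
  refine h2.congr fun R => ?_
  have := intervalIntegral.integral_comp_mul_left (a := 0) (b := R)
    (fun x => besselJ0 x * Real.sin (b / a * x)) ha.ne'
  simp only [mul_zero, smul_eq_mul] at this
  simp only [Function.comp, id]
  rw [← this]
  refine intervalIntegral.integral_congr fun x _ => ?_
  have e : b / a * (a * x) = b * x := by field_simp
  simp only [e]
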